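/- arXiv:0708.2304 — 2 statements merged into one kernel-verified Lean document; each statement's English description precedes it below -/
import Mathlib

section
/- Let f(x_1,x_2,x_3) = u_1x_1 + u_2x_2 + u_3x_3 be a ternary linear form with positive integer coefficients satisfying 1 ≤ u_1 ≤ u_2 ≤ u_3 and gcd(u_1,u_2,u_3) = 1, whose coefficients are not pairwise distinct. Then: (i) if u_1 = u_2 = u_3 = 1, then N_f(2) = 4; (ii) if u_1 = u_2 and u_3 = 2u_1, then N_f(2) = 5; (iii) if u_1 = u_2 and u_3 ≠ 2u_1, then N_f(2) = 6; (iv) if u_1 < u_2 = u_3, then N_f(2) = 6. -/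
open Finset

/-- The image set `f(A) = {u_1 a_1 + ⋯ + u_m a_m : a_i ∈ A}` of a finite set of integers
under the `m`-ary linear form with coefficients `u`. -/
def fimg (m : ℕ) (u : Fin m → ℤ) (A : Finset ℤ) : Finset ℤ :=
  (Fintype.piFinset fun _ : Fin m => A).image fun x => ∑ j, u j * x j

/-- `N_f(k) = min { |f(A)| : A ⊆ ℤ, |A| = k }`. -/
noncomputable def Nf (m : ℕ) (u : Fin m → ℤ) (k : ℕ) : ℕ :=
  sInf {n : ℕ | ∃ A : Finset ℤ, A.card = k ∧ (fimg m u A).card = n}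

/-- `M_f(k) = max { |f(A)| : A ⊆ ℤ, |A| = k }`. -/
noncomputable def Mf (m : ℕ) (u : Fin m → ℤ) (k : ℕ) : ℕ :=
  sSup {n : ℕ | ∃ A : Finset ℤ, A.card = k ∧ (fimg m u A).card = n}

/-- The subset sums of the three coefficients. -/
def subsums (p q r : ℤ) : Finset ℤ := {0, p, q, r, p + q, p + r, q + r, p + q + r}

lemma fimg_pair (p q r a b : ℤ) : fimg 3 ![p, q, r] {a, b} =
    (subsums p q r).image (fun s => (p + q + r) * a + (b - a) * s) := by
  ext y
  simp only [fimg, Finset.mem_image, Fintype.mem_piFinset, Fin.sum_univ_three]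
  constructor
  · rintro ⟨x, hx, rfl⟩
    have h0 := hx 0
    have h1 := hx 1
    have h2 := hx 2
    simp only [Finset.mem_insert, Finset.mem_singleton] at h0 h1 h2
    refine ⟨(if x 0 = a then 0 else p) + (if x 1 = a then 0 else q)
      + (if x 2 = a then 0 else r), ?_, ?_⟩
    · simp only [subsums, Finset.mem_insert, Finset.mem_singleton]
      split_ifs <;> simp
    · simp only [Matrix.cons_val]
      split_ifs <;> simp_all <;> ring
  · rintro ⟨s, hs, rfl⟩
    have key : ∀ x0 x1 x2 : ℤ, (x0 = a ∨ x0 = b) → (x1 = a ∨ x1 = b) → (x2 = a ∨ x2 = b) →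
        p * x0 + q * x1 + r * x2 = (p + q + r) * a + (b - a) * s →
        ∃ x : Fin 3 → ℤ, (∀ i, x i ∈ ({a, b} : Finset ℤ)) ∧
          ![p, q, r] 0 * x 0 + ![p, q, r] 1 * x 1 + ![p, q, r] 2 * x 2
            = (p + q + r) * a + (b - a) * s := by
      intro x0 x1 x2 h0 h1 h2 h
      refine ⟨![x0, x1, x2], ?_, by simpa using h⟩
      intro i
      fin_cases i <;> simpa
    simp only [subsums, Finset.mem_insert, Finset.mem_singleton] at hs
    rcases hs with h | h | h | h | h | h | h | h
    · exact key a a a (by simp) (by simp) (by simp) (by rw [h]; ring)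
    · exact key b a a (by simp) (by simp) (by simp) (by rw [h]; ring)
    · exact key a b a (by simp) (by simp) (by simp) (by rw [h]; ring)
    · exact key a a b (by simp) (by simp) (by simp) (by rw [h]; ring)
    · exact key b b a (by simp) (by simp) (by simp) (by rw [h]; ring)
    · exact key b a b (by simp) (by simp) (by simp) (by rw [h]; ring)
    · exact key a b b (by simp) (by simp) (by simp) (by rw [h]; ring)
    · exact key b b b (by simp) (by simp) (by simp) (by rw [h]; ring)

lemma card_fimg_pair (p q r a b : ℤ) (hab : a ≠ b) :
    (fimg 3 ![p, q, r] {a, b}).card = (subsums p q r).card := by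
  rw [fimg_pair]
  apply Finset.card_image_of_injective
  intro s t h
  have h' : (b - a) * s = (b - a) * t := by simpa using h
  exact mul_left_cancel₀ (sub_ne_zero.mpr hab.symm) h'

lemma Nf_two (p q r : ℤ) : Nf 3 ![p, q, r] 2 = (subsums p q r).card := by
  have : {n : ℕ | ∃ A : Finset ℤ, A.card = 2 ∧ (fimg 3 ![p, q, r] A).card = n}
      = {(subsums p q r).card} := by
    ext n
    simp only [Set.mem_ofPred_eq, Set.mem_singleton_iff]
    constructor
    · rintro ⟨A, hA, rfl⟩
      obtain ⟨a, b, hab, rfl⟩ := Finset.card_eq_two.mp hA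
      exact card_fimg_pair p q r a b hab
    · rintro rfl
      exact ⟨{0, 1}, by simp, card_fimg_pair p q r 0 1 (by simp)⟩
  rw [Nf, this, csInf_singleton]

lemma card_six (a b c d e f : ℤ) (h : [a, b, c, d, e, f].Nodup) :
    ({a, b, c, d, e, f} : Finset ℤ).card = 6 := by
  have := List.toFinset_card_of_nodup h
  simpa using this

lemma card_five (a b c d e : ℤ) (h : [a, b, c, d, e].Nodup) :
    ({a, b, c, d, e} : Finset ℤ).card = 5 := by
  have := List.toFinset_card_of_nodup h
  simpa using this

theorem stmt11 (u1 u2 u3 : ℤ) (h1 : 1 ≤ u1) (h12 : u1 ≤ u2) (h23 : u2 ≤ u3)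
    (hgcd : Int.gcd u1 (Int.gcd u2 u3) = 1)
    (hnotdistinct : u1 = u2 ∨ u2 = u3) :
    (u1 = 1 ∧ u2 = 1 ∧ u3 = 1 → Nf 3 ![u1, u2, u3] 2 = 4) ∧
    (u1 = u2 ∧ u3 = 2 * u1 → Nf 3 ![u1, u2, u3] 2 = 5) ∧
    (u1 = u2 ∧ u3 ≠ 2 * u1 ∧ ¬(u1 = 1 ∧ u2 = 1 ∧ u3 = 1) → Nf 3 ![u1, u2, u3] 2 = 6) ∧
    (u1 < u2 ∧ u2 = u3 → Nf 3 ![u1, u2, u3] 2 = 6) := by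
  rw [Nf_two]
  refine ⟨?_, ?_, ?_, ?_⟩
  · rintro ⟨rfl, rfl, rfl⟩
    decide
  · rintro ⟨rfl, rfl⟩
    have : subsums u1 u1 (2 * u1) = {0, u1, 2 * u1, 3 * u1, 4 * u1} := by
      ext y
      simp only [subsums, Finset.mem_insert, Finset.mem_singleton]
      omega
    rw [this]
    apply card_five
    simp
    omega
  · rintro ⟨rfl, hne, hn1⟩
    have hne' : u3 ≠ u1 := by
      rintro rfl
      have hu : u3 = 1 := by
        have hd : (u3.gcd (u3.gcd u3 : ℤ) : ℤ) = u3 := by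
          rw [Int.gcd_self, Int.natAbs_of_nonneg (by omega), Int.gcd_self,
            Int.natAbs_of_nonneg (by omega)]
        rw [hgcd] at hd
        exact_mod_cast hd.symm
      exact hn1 ⟨hu, hu, hu⟩
    have : subsums u1 u1 u3 = {0, u1, 2 * u1, u3, u3 + u1, u3 + 2 * u1} := by
      ext y
      simp only [subsums, Finset.mem_insert, Finset.mem_singleton]
      omega
    rw [this]
    apply card_six
    simp
    omega
  · rintro ⟨hlt, rfl⟩
    have : subsums u1 u2 u2 = {0, u2, 2 * u2, u1, u1 + u2, u1 + 2 * u2} := by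
      ext y
      simp only [subsums, Finset.mem_insert, Finset.mem_singleton]
      omega
    rw [this]
    apply card_six
    simp
    omega
end

section
/- Let (u_1,...,u_m) be a complete sequence of positive integers with U = u_1 + ⋯ + u_m, and let f(x_1,...,x_m) = u_1x_1 + ⋯ + u_mx_m. Then N_f(k) = Uk − U + 1 for every positive integer k. -/
open Finset

/-- A finite sequence `(u_1,…,u_m)` of positive integers is complete if its set of subset
sums is exactly the interval of integers `[0, U]`, where `U = u_1 + ⋯ + u_m`. -/
def IsCompleteSeq (m : ℕ) (u : Fin m → ℤ) : Prop :=
  (Finset.univ.powerset.image fun J : Finset (Fin m) => ∑ j ∈ J, u j)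
    = Finset.Icc 0 (∑ j, u j)

theorem fimg_lower (m : ℕ) (u : Fin m → ℤ) (hu : ∀ j, 0 < u j)
    (hcomp : IsCompleteSeq m u) (A : Finset ℤ) :
    A.Nonempty → (∑ j, u j) * A.card - (∑ j, u j) + 1 ≤ ((fimg m u A).card : ℤ) := by
  induction A using Finset.induction_on_max with
  | empty => simp
  | insert a s has ih =>
    intro _
    have hU : 0 ≤ ∑ j, u j := Finset.sum_nonneg fun j _ => (hu j).le
    have hnot : a ∉ s := fun h => lt_irrefl _ (has a h)
    rw [Finset.card_insert_of_notMem hnot]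
    rcases s.eq_empty_or_nonempty with rfl | hs
    · have : 0 < (fimg m u (insert a ∅)).card := by
        apply Finset.card_pos.mpr
        exact ⟨_, Finset.mem_image_of_mem _
          (Fintype.mem_piFinset.mpr (fun _ => Finset.mem_insert_self a ∅) :
            (fun _ => a) ∈ Fintype.piFinset fun _ : Fin m => insert a ∅)⟩
      simp at this ⊢
      omega
    · have ih := ih hs
      set b := s.max' hs with hb
      have hbs : b ∈ s := s.max'_mem hs
      have hba : b < a := has b hbs
      let T : Finset ℤ := (Finset.Icc 1 (∑ j, u j)).image fun t => (∑ j, u j) * b + t * (a - b)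
      have hT : T.card = (∑ j, u j).toNat := by
        rw [Finset.card_image_of_injective]
        · simp
        · intro x y hxy
          have : x * (a - b) = y * (a - b) := by simpa using hxy
          exact mul_right_cancel₀ (by omega) this
      have hdisj : Disjoint (fimg m u s) T := by
        rw [Finset.disjoint_left]
        intro x hx hx'
        obtain ⟨y, hy, rfl⟩ := Finset.mem_image.mp hx
        obtain ⟨t, ht, hte⟩ := Finset.mem_image.mp hx'
        have h1 : ∑ j, u j * y j ≤ (∑ j, u j) * b := by
          rw [Finset.sum_mul]
          exact Finset.sum_le_sum fun j _ => mul_le_mul_of_nonneg_left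
            (s.le_max' _ (Fintype.mem_piFinset.mp hy j)) (hu j).le
        have h2 : 0 < t * (a - b) := mul_pos (by have := (Finset.mem_Icc.mp ht).1; omega) (by omega)
        omega
      have hsub : fimg m u s ∪ T ⊆ fimg m u (insert a s) := by
        apply Finset.union_subset
        · exact Finset.image_subset_image
            (Fintype.piFinset_subset _ _ fun _ => Finset.subset_insert _ _)
        · intro x hx
          obtain ⟨t, ht, rfl⟩ := Finset.mem_image.mp hx
          have ht' : t ∈ Finset.Icc 0 (∑ j, u j) := by
            rw [Finset.mem_Icc] at ht ⊢; omega
          rw [← hcomp] at ht'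
          obtain ⟨J, _, rfl⟩ := Finset.mem_image.mp ht'
          refine Finset.mem_image.mpr ⟨fun j => if j ∈ J then a else b, ?_, ?_⟩
          · rw [Fintype.mem_piFinset]
            intro j
            by_cases h : j ∈ J <;> simp [h, hbs]
          · have : ∑ j ∈ J, u j = ∑ j, if j ∈ J then u j else 0 := by simp
            simp only
            rw [this, Finset.sum_mul, Finset.sum_mul, ← Finset.sum_add_distrib]
            refine Finset.sum_congr rfl fun j _ => ?_
            split_ifs <;> ring
      have hc := Finset.card_le_card hsub
      rw [Finset.card_union_of_disjoint hdisj, hT] at hc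
      push_cast
      zify at hc
      rw [Int.toNat_of_nonneg hU] at hc
      linarith

theorem fimg_upper (m : ℕ) (u : Fin m → ℤ) (hu : ∀ j, 0 < u j) (k : ℕ) (hk : 0 < k) :
    ((fimg m u (Finset.Ico 0 (k : ℤ))).card : ℤ) ≤ (∑ j, u j) * k - (∑ j, u j) + 1 := by
  have hU : 0 ≤ ∑ j, u j := Finset.sum_nonneg fun j _ => (hu j).le
  have hsub : fimg m u (Finset.Ico 0 (k : ℤ)) ⊆ Finset.Icc 0 ((∑ j, u j) * (k - 1)) := by
    intro x hx
    obtain ⟨y, hy, rfl⟩ := Finset.mem_image.mp hx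
    have hy' : ∀ j, 0 ≤ y j ∧ y j < k := fun j =>
      Finset.mem_Ico.mp (Fintype.mem_piFinset.mp hy j)
    rw [Finset.mem_Icc]
    refine ⟨Finset.sum_nonneg fun j _ => mul_nonneg (hu j).le (hy' j).1, ?_⟩
    rw [Finset.sum_mul]
    exact Finset.sum_le_sum fun j _ => mul_le_mul_of_nonneg_left
      (by have := (hy' j).2; omega) (hu j).le
  have hc := Finset.card_le_card hsub
  rw [Int.card_Icc] at hc
  have h0 : 0 ≤ (∑ j, u j) * ((k : ℤ) - 1) := mul_nonneg hU (by omega)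
  zify at hc
  rw [Int.toNat_of_nonneg (by omega)] at hc
  linarith

theorem stmt13 (m : ℕ) (hm : 0 < m) (u : Fin m → ℤ) (hu : ∀ j, 0 < u j)
    (hcomp : IsCompleteSeq m u) (k : ℕ) (hk : 0 < k) :
    (Nf m u k : ℤ) = (∑ j, u j) * k - (∑ j, u j) + 1 := by
  have hmem : (fimg m u (Finset.Ico 0 (k : ℤ))).card ∈
      {n : ℕ | ∃ A : Finset ℤ, A.card = k ∧ (fimg m u A).card = n} := ⟨_, by simp, rfl⟩
  apply le_antisymm
  · have h1 : Nf m u k ≤ _ := Nat.sInf_le hmem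
    have h2 := fimg_upper m u hu k hk
    have h3 : (Nf m u k : ℤ) ≤ _ := Int.ofNat_le.mpr h1
    exact h3.trans h2
  · obtain ⟨A, hA, hN⟩ := Nat.sInf_mem ⟨_, hmem⟩
    have h := fimg_lower m u hu hcomp A (Finset.card_pos.mp (by omega))
    rw [hA, hN] at h
    exact h
end
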